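/- For every r > 0 there exists λ* > 0 such that for all 0 < λ < λ* and every z ∈ A(r,λ): (i) ‖v(z)‖ ≤ √2·λ·(2‖z‖∞ + 5) (Euclidean norm); (ii) |𝒫(F_λ(z)) − 𝒫(z)| ≤ 2λ(‖z‖∞ + 3)²; and (iii) |𝒫(F_λ⁴(z)) − 𝒫(z)| ≤ 2λ(2‖z‖∞ + 5)². -/

import Mathlib

open Filter Topology

/-- The discretised rotation `F(x,y) = (⌊λx⌋ − y, x)` as a permutation of `ℤ²`. -/
noncomputable def Fe (lam : ℝ) : Equiv.Perm (ℤ × ℤ) where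
  toFun p := (⌊lam * p.1⌋ - p.2, p.1)
  invFun p := (p.2, ⌊lam * p.2⌋ - p.1)
  left_inv p := by simp
  right_inv p := by simp

/-- The point of `(λℤ)² ⊂ ℝ²` with lattice index `p ∈ ℤ²`. -/
noncomputable def pt (lam : ℝ) (p : ℤ × ℤ) : ℝ × ℝ := (lam * p.1, lam * p.2)

/-- The set `A(r,λ) = {z ∈ (λℤ)² : ‖z‖∞ < r}`, described by lattice indices. -/
def Aset (r lam : ℝ) : Set (ℤ × ℤ) := {p | max |lam * p.1| |lam * p.2| < r}

/-- The piecewise-affine function `P(x) = ⌊x⌋² + (2⌊x⌋+1)(x − ⌊x⌋)`. -/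
noncomputable def Pfun (x : ℝ) : ℝ := (⌊x⌋ : ℝ)^2 + (2*(⌊x⌋ : ℝ)+1)*(x - ⌊x⌋)

/-- The piecewise-affine Hamiltonian `𝒫(x,y) = P(x) + P(y)`. -/
noncomputable def ham (z : ℝ × ℝ) : ℝ := Pfun z.1 + Pfun z.2

lemma Pfun_support (u : ℝ) (m : ℤ) : (2*(m:ℝ)+1)*u - (m:ℝ)^2 - m ≤ Pfun u := by
  unfold Pfun
  have h1 := Int.floor_le u
  have h2 := Int.lt_floor_add_one u
  generalize ⌊u⌋ = n at *
  rcases lt_trichotomy n m with h | h | h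
  · have h' : (n:ℝ) + 1 ≤ m := by exact_mod_cast h
    nlinarith [mul_nonneg (by linarith : (0:ℝ) ≤ m - n) (by linarith : (0:ℝ) ≤ n + m + 1 - 2*u)]
  · subst h
    nlinarith
  · have h' : (m:ℝ) + 1 ≤ n := by exact_mod_cast h
    nlinarith [mul_nonneg (by linarith : (0:ℝ) ≤ n - m) (by linarith : (0:ℝ) ≤ 2*u - n - m - 1)]

lemma Pfun_eq (u : ℝ) : Pfun u = (2*(⌊u⌋:ℝ)+1)*u - (⌊u⌋:ℝ)^2 - ⌊u⌋ := by
  unfold Pfun; ring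

lemma Pfun_le_neg (u : ℝ) : Pfun u ≤ Pfun (-u) := by
  have h := Pfun_support (-u) (-⌊u⌋ - 1)
  rw [Pfun_eq u]
  push_cast at h
  nlinarith

lemma Pfun_neg (u : ℝ) : Pfun (-u) = Pfun u :=
  le_antisymm (by simpa using Pfun_le_neg (-u)) (Pfun_le_neg u)

lemma slope_bound (u K : ℝ) (h : |u| ≤ K) : |2*(⌊u⌋:ℝ)+1| ≤ 2*K+1 := by
  have h1 := Int.floor_le u
  have h2 := Int.lt_floor_add_one u
  rw [abs_le] at *
  constructor <;> linarith

lemma Pfun_sub_le (u w K : ℝ) (hu : |u| ≤ K) : Pfun u - Pfun w ≤ (2*K+1)*|u-w| := by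
  have h := Pfun_support w ⌊u⌋
  rw [Pfun_eq u]
  calc _ ≤ (2*(⌊u⌋:ℝ)+1)*(u-w) := by linarith
    _ ≤ |(2*(⌊u⌋:ℝ)+1)*(u-w)| := le_abs_self _
    _ = |2*(⌊u⌋:ℝ)+1| * |u-w| := abs_mul _ _
    _ ≤ _ := mul_le_mul_of_nonneg_right (slope_bound u K hu) (abs_nonneg _)

lemma Pfun_lip (u w K : ℝ) (hu : |u| ≤ K) (hw : |w| ≤ K) :
    |Pfun u - Pfun w| ≤ (2*K+1)*|u-w| := by
  rw [abs_le]
  have h1 := Pfun_sub_le u w K hu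
  have h2 := Pfun_sub_le w u K hw
  rw [abs_sub_comm w u] at h2
  constructor <;> linarith

lemma floor_abs (u K : ℝ) (h : |u| ≤ K) : |(⌊u⌋:ℝ)| ≤ K + 1 := by
  have h1 := Int.floor_le u
  have h2 := Int.lt_floor_add_one u
  rw [abs_le] at *
  constructor <;> linarith

lemma lam_mul_abs (lam t K : ℝ) (hl : 0 < lam) (h : |t| ≤ K) (hK : lam * K ≤ 1/2) :
    |lam * t| ≤ 1/2 := by
  rw [abs_mul, abs_of_pos hl]
  exact (mul_le_mul_of_nonneg_left h hl.le).trans hK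

lemma shift_bound (lam X M t : ℝ) (hl : 0 < lam) (hM : 0 ≤ M) (hX : |X| ≤ M)
    (ht : |t| ≤ 2*M+5) (hlM : lam * (2*M+10) ≤ 1) :
    |Pfun (X + lam * t) - Pfun X| ≤ lam * (2*M+5)^2 := by
  have h1 : |lam * t| ≤ lam * (2*M+5) := by
    rw [abs_mul, abs_of_pos hl]
    exact mul_le_mul_of_nonneg_left ht hl.le
  have h2 : |X + lam * t| ≤ M + 1 := (abs_add_le _ _).trans (by nlinarith)
  have h := Pfun_lip (X + lam * t) X (M+1) h2 (by linarith)
  rw [add_sub_cancel_left] at h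
  have : (2*(M+1)+1)*|lam*t| ≤ (2*(M+1)+1)*(lam * (2*M+5)) :=
    mul_le_mul_of_nonneg_left h1 (by linarith)
  nlinarith [mul_nonneg hl.le hM]

/-- For every `r > 0` there is `λ* > 0` such that for all `0 < λ < λ*` and every
`z ∈ A(r,λ)`: (i) the Euclidean norm of `v(z) = F_λ⁴(z) − z` is at most
`√2·λ·(2‖z‖∞+5)`; (ii) `|𝒫(F_λ(z)) − 𝒫(z)| ≤ 2λ(‖z‖∞+3)²`; and (iii)
`|𝒫(F_λ⁴(z)) − 𝒫(z)| ≤ 2λ(2‖z‖∞+5)²`. -/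
theorem v_norm_and_ham_increment_bounds (r : ℝ) (hr : 0 < r) :
    ∃ lamstar > (0:ℝ), ∀ lam : ℝ, 0 < lam → lam < lamstar →
      ∀ p ∈ Aset r lam,
        (Real.sqrt
            (((pt lam ((Fe lam ^ 4) p)).1 - (pt lam p).1)^2 +
             ((pt lam ((Fe lam ^ 4) p)).2 - (pt lam p).2)^2)
          ≤ Real.sqrt 2 * lam * (2 * max |(pt lam p).1| |(pt lam p).2| + 5)) ∧
        (|ham (pt lam ((Fe lam) p)) - ham (pt lam p)|
          ≤ 2 * lam * (max |(pt lam p).1| |(pt lam p).2| + 3)^2) ∧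
        (|ham (pt lam ((Fe lam ^ 4) p)) - ham (pt lam p)|
          ≤ 2 * lam * (2 * max |(pt lam p).1| |(pt lam p).2| + 5)^2) := by
  refine ⟨1/(2*r+10), by positivity, ?_⟩
  intro lam hl hlt p hp
  obtain ⟨x, y⟩ := p
  simp only [Aset, Set.mem_ofPred_eq] at hp
  have hlr : lam * (2*r+10) < 1 := by rwa [lt_div_iff₀ (by linarith)] at hlt
  have e4 : (Fe lam ^ 4) (x, y) = Fe lam (Fe lam (Fe lam (Fe lam (x, y)))) := rfl
  rw [e4]
  simp only [Fe, Equiv.coe_fn_mk, pt, ham]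
  set M := max |lam * (x:ℝ)| |lam * (y:ℝ)| with hMdef
  have hX : |lam * (x:ℝ)| ≤ M := le_max_left _ _
  have hY : |lam * (y:ℝ)| ≤ M := le_max_right _ _
  have hM : 0 ≤ M := (abs_nonneg _).trans hX
  clear_value M
  have hlM : lam * (2*M+10) ≤ 1 := by nlinarith
  have hl2 : lam * (M+5) ≤ 1/2 := by linarith
  set a : ℤ := ⌊lam * (x:ℝ)⌋ with ha
  have haM : |(a:ℝ)| ≤ M + 1 := floor_abs _ _ hX
  have hla : |lam * (a:ℝ)| ≤ 1/2 := lam_mul_abs _ _ (M+5) hl (by linarith) hl2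
  set b : ℤ := ⌊lam * ((a - y : ℤ):ℝ)⌋ with hb
  have hbarg : |lam * ((a - y : ℤ):ℝ)| ≤ M + 1/2 := by
    push_cast
    rw [mul_sub]
    exact (abs_sub _ _).trans (by linarith)
  have hbM : |(b:ℝ)| ≤ M + 1/2 + 1 := floor_abs _ _ hbarg
  have hlb : |lam * (b:ℝ)| ≤ 1/2 := lam_mul_abs _ _ (M+5) hl (by linarith) hl2
  set c : ℤ := ⌊lam * ((b - x : ℤ):ℝ)⌋ with hc
  have hcarg : |lam * ((b - x : ℤ):ℝ)| ≤ M + 1/2 := by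
    push_cast
    rw [mul_sub]
    exact (abs_sub _ _).trans (by linarith)
  have hcM : |(c:ℝ)| ≤ M + 1/2 + 1 := floor_abs _ _ hcarg
  have hlc : |lam * (c:ℝ)| ≤ 1/2 := lam_mul_abs _ _ (M+5) hl (by linarith) hl2
  set d : ℤ := ⌊lam * ((c - (a - y) : ℤ):ℝ)⌋ with hd
  have a1 := Int.floor_le (lam * (x:ℝ))
  have a2 := Int.lt_floor_add_one (lam * (x:ℝ))
  have b1 := Int.floor_le (lam * ((a - y : ℤ):ℝ))
  have b2 := Int.lt_floor_add_one (lam * ((a - y : ℤ):ℝ))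
  have c1 := Int.floor_le (lam * ((b - x : ℤ):ℝ))
  have c2 := Int.lt_floor_add_one (lam * ((b - x : ℤ):ℝ))
  have d1 := Int.floor_le (lam * ((c - (a - y) : ℤ):ℝ))
  have d2 := Int.lt_floor_add_one (lam * ((c - (a - y) : ℤ):ℝ))
  rw [← ha] at a1 a2
  rw [← hb] at b1 b2
  rw [← hc] at c1 c2
  rw [← hd] at d1 d2
  clear_value a b c d
  clear ha hb hc hd
  push_cast at b1 b2 c1 c2 d1 d2
  have hX' := abs_le.mp hX
  have hY' := abs_le.mp hY
  have hla' := abs_le.mp hla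
  have hlb' := abs_le.mp hlb
  have hlc' := abs_le.mp hlc
  have hca : |(c:ℝ) - a| ≤ 2*M+5 := by
    rw [abs_le]; constructor <;> linarith
  have hdb : |(d:ℝ) - b| ≤ 2*M+5 := by
    rw [abs_le]; constructor <;> linarith
  have E1 : lam * ((d - (b - x) : ℤ):ℝ) = lam * x + lam * ((d:ℝ) - b) := by
    push_cast; ring
  have E2 : lam * ((c - (a - y) : ℤ):ℝ) = lam * y + lam * ((c:ℝ) - a) := by
    push_cast; ring
  rw [E1, E2]
  refine ⟨?_, ?_, ?_⟩
  · have hs : Real.sqrt 2 * lam * (2*M+5) = Real.sqrt (2 * (lam * (2*M+5))^2) := by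
      rw [Real.sqrt_mul (by norm_num), Real.sqrt_sq (by positivity), mul_assoc]
    rw [hs]
    apply Real.sqrt_le_sqrt
    have q1 := sq_le_sq' (abs_le.mp hca).1 (abs_le.mp hca).2
    have q2 := sq_le_sq' (abs_le.mp hdb).1 (abs_le.mp hdb).2
    nlinarith [mul_le_mul_of_nonneg_left q1 (sq_nonneg lam),
      mul_le_mul_of_nonneg_left q2 (sq_nonneg lam)]
  · have h1 : |lam * (a:ℝ)| ≤ lam * (M+1) := by
      rw [abs_mul, abs_of_pos hl]
      exact mul_le_mul_of_nonneg_left haM hl.le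
    have h2 : |-(lam * (y:ℝ)) + lam * a| ≤ M + 1 :=
      (abs_add_le _ _).trans (by rw [abs_neg]; linarith)
    have h3 := Pfun_lip _ (-(lam * (y:ℝ))) (M+1) h2 (by rw [abs_neg]; linarith)
    rw [add_sub_cancel_left, Pfun_neg] at h3
    have h4 : (2*(M+1)+1)*|lam*(a:ℝ)| ≤ (2*(M+1)+1)*(lam * (M+1)) :=
      mul_le_mul_of_nonneg_left h1 (by linarith)
    have E3 : lam * ((a - y : ℤ):ℝ) = -(lam * y) + lam * a := by push_cast; ring
    rw [E3]
    have E4 : Pfun (-(lam * (y:ℝ)) + lam * a) + Pfun (lam * x) - (Pfun (lam * x) + Pfun (lam * y))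
        = Pfun (-(lam * (y:ℝ)) + lam * a) - Pfun (lam * y) := by ring
    rw [E4]
    refine h3.trans (h4.trans ?_)
    have h5 : 0 ≤ lam * (7*M+15) := by positivity
    linarith [show 2 * lam * (M+3)^2 - (2*(M+1)+1)*(lam * (M+1)) = lam * (7*M+15) by ring]
  · have h1 := abs_le.mp (shift_bound lam (lam * x) M (d - b) hl hM hX hdb hlM)
    have h2 := abs_le.mp (shift_bound lam (lam * y) M (c - a) hl hM hY hca hlM)
    rw [abs_le]; constructor <;> linarith
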